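/- Let n ≥ 1, let Ω ⊂ ℝⁿ be a bounded open set, and let u₁, u₂ : closure(Ω) → ℝ be continuous functions that are C¹ on Ω and spacelike, i.e. |∇u₁(x)| < 1 and |∇u₂(x)| < 1 for all x ∈ Ω. Suppose u₁ ≥ u₂ on closure(Ω), u₁ = u₂ on ∂Ω, and u₁ is convex on Ω. Then ∫_Ω √(1 − |∇u₁(x)|²) dx ≥ ∫_Ω √(1 − |∇u₂(x)|²) dx, and equality holds if and only if u₁ = u₂ on Ω. -/

import Mathlib

open Real Filter
open MeasureTheory Set
open scoped Topology Gradient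

section GaussianAverage

variable {E : Type*} [NormedAddCommGroup E] [InnerProductSpace ℝ E]

lemma rexp_neg_sq_mul_exp_inner_mul_inner_le {p q : E} {M : ℝ} (hp : ‖p‖ ≤ 1) (hq : ‖q‖ ≤ M)
    (e : E) (s : ℝ) :
    ‖rexp (-‖e‖ ^ 2) * (rexp (inner ℝ ((2 * s) • e) p) * inner ℝ ((2 * s) • e) q)‖ ≤
      M * rexp (8 * s ^ 2) * rexp (-(1 / 2) * ‖e‖ ^ 2) := by
  have hM : 0 ≤ M := (norm_nonneg q).trans hq
  set a := (2 * s) • e with ha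
  have hna : ‖a‖ = 2 * |s| * ‖e‖ := by simp [ha, norm_smul]
  have h1 : inner ℝ a p ≤ ‖a‖ :=
    (real_inner_le_norm a p).trans (mul_le_of_le_one_right (norm_nonneg _) hp)
  have h2 : |inner ℝ a q| ≤ rexp ‖a‖ * M :=
    (abs_real_inner_le_norm a q).trans
      (mul_le_mul (by linarith [add_one_le_exp ‖a‖]) hq (norm_nonneg _) (exp_pos _).le)
  rw [norm_mul, norm_mul, norm_eq_abs, norm_eq_abs, norm_eq_abs, abs_exp, abs_exp]
  calc rexp (-‖e‖ ^ 2) * (rexp (inner ℝ a p) * |inner ℝ a q|)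
      ≤ rexp (-‖e‖ ^ 2) * (rexp ‖a‖ * (rexp ‖a‖ * M)) := by gcongr
    _ = M * rexp (-‖e‖ ^ 2 + ‖a‖ + ‖a‖) := by rw [exp_add, exp_add]; ring
    _ ≤ M * rexp (8 * s ^ 2 + -(1 / 2) * ‖e‖ ^ 2) := by
        refine mul_le_mul_of_nonneg_left (exp_le_exp.2 ?_) hM
        rw [hna]
        nlinarith [sq_nonneg (‖e‖ - 4 * |s|), sq_abs s]
    _ = _ := by rw [exp_add]; ring

variable [FiniteDimensional ℝ E] [MeasurableSpace E] [BorelSpace E]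

lemma integrable_rexp_neg_mul_sq_norm {b : ℝ} (hb : 0 < b) :
    Integrable fun e : E => rexp (-b * ‖e‖ ^ 2) := by
  have h := (GaussianFourier.integrable_cexp_neg_mul_sq_norm_add (V := E) (b := (b : ℂ))
    (by simpa using hb) 0 0).re
  refine h.congr (ae_of_all _ fun e => ?_)
  have : (-(b : ℂ) * (‖e‖ : ℂ) ^ 2 + 0 * ((inner ℝ (0 : E) e : ℝ) : ℂ)) =
      ((-b * ‖e‖ ^ 2 : ℝ) : ℂ) := by push_cast; ring
  simp only [this]
  exact Complex.exp_ofReal_re _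

lemma integrable_rexp_neg_sq_norm_mul_inner (q : E) :
    Integrable fun e : E => rexp (-‖e‖ ^ 2) * inner ℝ e q := by
  refine ((integrable_rexp_neg_mul_sq_norm (E := E) (b := 1 / 2) (by norm_num)).const_mul
    (‖q‖ * rexp (8 * (1 / 2) ^ 2))).mono' (by fun_prop) (ae_of_all _ fun e => ?_)
  simpa using rexp_neg_sq_mul_exp_inner_mul_inner_le (p := 0) (by simp) (le_refl ‖q‖) e (1 / 2)

/-- The Gaussian average of `exp ⟪2se, p⟫ ⟪2se, q⟫` over all directions `e`. -/
lemma integral_rexp_neg_sq_mul_exp_inner_mul_inner (p q : E) (s : ℝ) :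
    ∫ e : E, rexp (-‖e‖ ^ 2) * (rexp (inner ℝ ((2 * s) • e) p) * inner ℝ ((2 * s) • e) q) =
      2 * s ^ 2 * (∫ e : E, rexp (-‖e‖ ^ 2)) * (rexp (s ^ 2 * ‖p‖ ^ 2) * inner ℝ p q) := by
  rw [← integral_add_right_eq_self (μ := volume) _ (s • p)]
  have key : ∀ e : E, rexp (-‖e + s • p‖ ^ 2) *
      (rexp (inner ℝ ((2 * s) • (e + s • p)) p) * inner ℝ ((2 * s) • (e + s • p)) q) =
      2 * s * rexp (s ^ 2 * ‖p‖ ^ 2) * (rexp (-‖e‖ ^ 2) * inner ℝ e q) +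
      2 * s ^ 2 * rexp (s ^ 2 * ‖p‖ ^ 2) * inner ℝ p q * rexp (-‖e‖ ^ 2) := by
    intro e
    have h1 : -‖e + s • p‖ ^ 2 + inner ℝ ((2 * s) • (e + s • p)) p =
        s ^ 2 * ‖p‖ ^ 2 + -‖e‖ ^ 2 := by
      rw [norm_add_sq_real, norm_smul, mul_pow, norm_eq_abs, sq_abs]
      simp only [inner_smul_left, inner_smul_right, inner_add_left, real_inner_self_eq_norm_sq]
      simp; ring
    rw [← mul_assoc, ← exp_add, h1, exp_add]
    simp only [inner_smul_left, inner_add_left]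
    simp; ring
  have hodd : ∫ e : E, rexp (-‖e‖ ^ 2) * inner ℝ e q = 0 := by
    have h := integral_neg_eq_self (fun e : E => rexp (-‖e‖ ^ 2) * inner ℝ e q) volume
    simp only [norm_neg, inner_neg_left, mul_neg, integral_neg] at h
    linarith
  simp_rw [key]
  rw [integral_add ((integrable_rexp_neg_sq_norm_mul_inner q).const_mul _)
    (by simpa using (integrable_rexp_neg_mul_sq_norm (E := E) one_pos).const_mul _),
    integral_const_mul, integral_const_mul, hodd]
  ring

variable {α : Type*} [MeasurableSpace α] {μ : Measure α} [IsFiniteMeasure μ] {p q : α → E}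

lemma integral_exp_sq_mul_inner_nonpos {M : ℝ}
    (hp : AEStronglyMeasurable p μ) (hq : AEStronglyMeasurable q μ)
    (hp1 : ∀ᵐ x ∂μ, ‖p x‖ ≤ 1) (hqM : ∀ᵐ x ∂μ, ‖q x‖ ≤ M)
    (h : ∀ e : E, ∫ x, rexp (inner ℝ e (p x)) * inner ℝ e (q x) ∂μ ≤ 0) {s : ℝ} (hs : 0 < s) :
    ∫ x, rexp (s ^ 2 * ‖p x‖ ^ 2) * inner ℝ (p x) (q x) ∂μ ≤ 0 := by
  set G : ℝ := ∫ e : E, rexp (-‖e‖ ^ 2) with hG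
  have hGpos : 0 < G := by
    have := GaussianFourier.integral_rexp_neg_mul_sq_norm (V := E) one_pos
    simp only [neg_mul, one_mul, div_one] at this
    rw [hG, this]
    positivity
  have hint : Integrable (Function.uncurry fun (x : α) (e : E) => rexp (-‖e‖ ^ 2) *
      (rexp (inner ℝ ((2 * s) • e) (p x)) * inner ℝ ((2 * s) • e) (q x)))
      (μ.prod volume) := by
    have hb : Integrable (fun z : α × E => (M * rexp (8 * s ^ 2)) * rexp (-(1 / 2) * ‖z.2‖ ^ 2))
        (μ.prod volume) :=
      (((integrable_rexp_neg_mul_sq_norm (E := E) (b := 1 / 2) (by norm_num)).comp_snd μ)).const_mul _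
    refine hb.mono' ?_ ?_
    · have hp' : AEStronglyMeasurable (fun z : α × E => p z.1) (μ.prod volume) := hp.comp_fst
      have hq' : AEStronglyMeasurable (fun z : α × E => q z.1) (μ.prod volume) := hq.comp_fst
      have he : AEStronglyMeasurable (fun z : α × E => (2 * s) • z.2) (μ.prod volume) :=
        (measurable_snd.const_smul (2 * s)).aestronglyMeasurable
      have hn : AEStronglyMeasurable (fun z : α × E => rexp (-‖z.2‖ ^ 2)) (μ.prod volume) :=
        (by fun_prop : Measurable fun z : α × E => rexp (-‖z.2‖ ^ 2)).aestronglyMeasurable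
      exact hn.mul ((continuous_exp.comp_aestronglyMeasurable (he.inner hp')).mul (he.inner hq'))
    · have h1 : ∀ᵐ z ∂(μ.prod (volume : Measure E)), ‖p z.1‖ ≤ 1 ∧ ‖q z.1‖ ≤ M :=
        Measure.quasiMeasurePreserving_fst.ae (hp1.and hqM)
      filter_upwards [h1] with z hz
      exact rexp_neg_sq_mul_exp_inner_mul_inner_le hz.1 hz.2 z.2 s
  have hswap := integral_integral_swap hint
  simp only [integral_rexp_neg_sq_mul_exp_inner_mul_inner, integral_const_mul] at hswap
  have hle : ∫ e : E, rexp (-‖e‖ ^ 2) *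
      ∫ x, rexp (inner ℝ ((2 * s) • e) (p x)) * inner ℝ ((2 * s) • e) (q x) ∂μ ≤ 0 :=
    integral_nonpos fun e => mul_nonpos_of_nonneg_of_nonpos (exp_pos _).le (h _)
  rw [← hswap] at hle
  by_contra! hcon
  exact absurd hle (not_le.2 (by positivity))

lemma integral_inner_div_sqrt_nonpos {M r : ℝ} (hr0 : 0 ≤ r) (hr : r < 1)
    (hp : AEStronglyMeasurable p μ) (hq : AEStronglyMeasurable q μ)
    (hp1 : ∀ᵐ x ∂μ, ‖p x‖ ≤ 1) (hqM : ∀ᵐ x ∂μ, ‖q x‖ ≤ M)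
    (hpr : ∀ᵐ x ∂μ, q x ≠ 0 → ‖p x‖ ≤ r)
    (h : ∀ e : E, ∫ x, rexp (inner ℝ e (p x)) * inner ℝ e (q x) ∂μ ≤ 0) :
    Integrable (fun x => inner ℝ (p x) (q x) / √(1 - ‖p x‖ ^ 2)) μ ∧
    ∫ x, inner ℝ (p x) (q x) / √(1 - ‖p x‖ ^ 2) ∂μ ≤ 0 := by
  set ν : Measure ℝ := volume.restrict (Ioi 0)
  have hr2 : 0 < 1 - r ^ 2 := by nlinarith
  have hint : Integrable (Function.uncurry fun (x : α) (s : ℝ) => rexp (-s ^ 2) *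
      (rexp (s ^ 2 * ‖p x‖ ^ 2) * inner ℝ (p x) (q x))) (μ.prod ν) := by
    have hb : Integrable (fun z : α × ℝ => M * rexp (-(1 - r ^ 2) * z.2 ^ 2)) (μ.prod ν) :=
      (((integrable_exp_neg_mul_sq hr2).restrict (s := Ioi 0)).comp_snd μ).const_mul _
    refine hb.mono' ?_ ?_
    · have hp' : AEStronglyMeasurable (fun z : α × ℝ => p z.1) (μ.prod ν) := hp.comp_fst
      have hq' : AEStronglyMeasurable (fun z : α × ℝ => q z.1) (μ.prod ν) := hq.comp_fst
      have he : AEStronglyMeasurable (fun z : α × ℝ => z.2 ^ 2) (μ.prod ν) :=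
        (measurable_snd.pow_const 2).aestronglyMeasurable
      exact (continuous_exp.comp_aestronglyMeasurable he.neg).mul
        ((continuous_exp.comp_aestronglyMeasurable (he.mul (hp'.norm.pow 2))).mul (hp'.inner hq'))
    · have h1 : ∀ᵐ z ∂(μ.prod ν), (‖p z.1‖ ≤ 1 ∧ ‖q z.1‖ ≤ M) ∧ (q z.1 ≠ 0 → ‖p z.1‖ ≤ r) :=
        Measure.quasiMeasurePreserving_fst.ae ((hp1.and hqM).and hpr)
      filter_upwards [h1] with ⟨x, s⟩ ⟨⟨hx1, hxM⟩, hxr⟩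
      simp only [Function.uncurry] at *
      have hM : 0 ≤ M := (norm_nonneg _).trans hxM
      by_cases hq0 : q x = 0
      · simp only [hq0, inner_zero_right, mul_zero, norm_zero]; positivity
      have hx := hxr hq0
      have hin : |inner ℝ (p x) (q x)| ≤ M := (abs_real_inner_le_norm _ _).trans
        ((mul_le_of_le_one_left (norm_nonneg _) hx1).trans hxM)
      rw [← mul_assoc, ← exp_add, norm_mul, norm_eq_abs, norm_eq_abs, abs_exp, mul_comm]
      gcongr
      have : ‖p x‖ ^ 2 ≤ r ^ 2 := by gcongr
      nlinarith [sq_nonneg s]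
  have hinner : ∀ x, ∫ s, rexp (-s ^ 2) *
      (rexp (s ^ 2 * ‖p x‖ ^ 2) * inner ℝ (p x) (q x)) ∂ν =
      √π / 2 * (inner ℝ (p x) (q x) / √(1 - ‖p x‖ ^ 2)) := by
    intro x
    have : ∀ s : ℝ, rexp (-s ^ 2) * (rexp (s ^ 2 * ‖p x‖ ^ 2) * inner ℝ (p x) (q x)) =
        rexp (-(1 - ‖p x‖ ^ 2) * s ^ 2) * inner ℝ (p x) (q x) := by
      intro s
      rw [← mul_assoc, ← exp_add]
      ring_nf
    simp_rw [this]
    rw [integral_mul_const, integral_gaussian_Ioi, sqrt_div pi_pos.le]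
    ring
  have hc : 0 < √π / 2 := by positivity
  constructor
  · have h1 := hint.integral_prod_left.congr (ae_of_all _ hinner)
    exact (integrable_const_mul_iff (IsUnit.mk0 _ hc.ne') _).1 h1
  · have hswap := integral_integral_swap hint
    rw [integral_congr_ae (ae_of_all _ hinner), integral_const_mul] at hswap
    have hle : ∫ s, ∫ x, rexp (-s ^ 2) *
        (rexp (s ^ 2 * ‖p x‖ ^ 2) * inner ℝ (p x) (q x)) ∂μ ∂ν ≤ 0 := by
      refine integral_nonpos_of_ae ?_
      filter_upwards [ae_restrict_mem measurableSet_Ioi] with s hs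
      rw [integral_const_mul]
      exact mul_nonpos_of_nonneg_of_nonpos (exp_pos _).le
        (integral_exp_sq_mul_inner_nonpos hp hq hp1 hqM h hs)
    rw [← hswap] at hle
    by_contra! hcon
    exact absurd hle (not_le.2 (by positivity))

end GaussianAverage

section ConvexVariation

variable {E : Type*} [NormedAddCommGroup E] [InnerProductSpace ℝ E] [CompleteSpace E]

lemma ContDiffOn.continuousOn_gradient {Ω : Set E} (hΩ : IsOpen Ω) {u : E → ℝ}
    (hu : ContDiffOn ℝ 1 u Ω) : ContinuousOn (∇ u) Ω :=
  (InnerProductSpace.toDual ℝ E).symm.continuous.comp_continuousOn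
    (hu.continuousOn_fderiv_of_isOpen hΩ le_rfl)

lemma ConvexOn.inner_gradient_sub_smul_le {Ω : Set E} {u : E → ℝ} (hu : ConvexOn ℝ Ω u)
    {x e : E} {t : ℝ} (ht : 0 < t) (hx : x ∈ Ω) (hxt : x - t • e ∈ Ω)
    (hdx : DifferentiableAt ℝ u x) (hdxt : DifferentiableAt ℝ u (x - t • e)) :
    inner ℝ e (∇ u (x - t • e)) ≤ inner ℝ e (∇ u x) := by
  have hline : ∀ s : ℝ, HasDerivAt (fun s : ℝ => x + s • e) e s := fun s => by
    simpa using ((hasDerivAt_id s).smul_const e).const_add x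
  have hcx : ConvexOn ℝ ((AffineMap.lineMap x (x + e) : ℝ →ᵃ[ℝ] E) ⁻¹' Ω)
      (u ∘ (AffineMap.lineMap x (x + e) : ℝ →ᵃ[ℝ] E)) := hu.comp_affineMap _
  have hl : ∀ s : ℝ, (AffineMap.lineMap x (x + e) : ℝ →ᵃ[ℝ] E) s = x + s • e := fun s => by
    simp [AffineMap.lineMap_apply, add_comm]
  have hfun : (u ∘ (AffineMap.lineMap x (x + e) : ℝ →ᵃ[ℝ] E)) = fun s => u (x + s • e) :=
    funext fun s => by simp [hl]
  rw [hfun] at hcx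
  have hneg : x + (-t) • e = x - t • e := by rw [neg_smul, sub_eq_add_neg]
  have h0 : HasDerivAt (fun s : ℝ => u (x + s • e)) (fderiv ℝ u x e) 0 :=
    HasFDerivAt.comp_hasDerivAt_of_eq 0 hdx.hasFDerivAt (hline 0) (by simp)
  have h1 : HasDerivAt (fun s : ℝ => u (x + s • e)) (fderiv ℝ u (x - t • e) e) (-t) :=
    HasFDerivAt.comp_hasDerivAt_of_eq (-t) hdxt.hasFDerivAt (hline (-t)) hneg.symm
  have hm0 : (0 : ℝ) ∈ (AffineMap.lineMap x (x + e) : ℝ →ᵃ[ℝ] E) ⁻¹' Ω := by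
    simpa [hl] using hx
  have hm1 : -t ∈ (AffineMap.lineMap x (x + e) : ℝ →ᵃ[ℝ] E) ⁻¹' Ω := by
    rw [mem_preimage, hl, hneg]; exact hxt
  have hlt : -t < 0 := by linarith
  have := (hcx.le_slope_of_hasDerivAt hm1 hm0 hlt h1).trans
    (hcx.slope_le_of_hasDerivAt hm1 hm0 hlt h0)
  rw [real_inner_comm, real_inner_comm _ e, inner_gradient_left, inner_gradient_left]
  exact this

variable [FiniteDimensional ℝ E] [MeasurableSpace E] [BorelSpace E]

lemma ConvexOn.integral_exp_inner_gradient_mul_nonpos {Ω : Set E} (hΩ : IsOpen Ω)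
    (hΩb : Bornology.IsBounded Ω) {u v : E → ℝ} (hu : ConvexOn ℝ Ω u)
    (hud : ContDiffOn ℝ 1 u Ω) (hu1 : ∀ x ∈ Ω, ‖∇ u x‖ < 1)
    (hv : ContDiff ℝ 1 v) (hv0 : ∀ x, 0 ≤ v x) (hvc : HasCompactSupport v)
    (hvΩ : tsupport v ⊆ Ω) (e : E) :
    ∫ x in Ω, rexp (inner ℝ e (∇ u x)) * inner ℝ e (∇ v x) ≤ 0 := by
  have hΩm : MeasurableSet Ω := hΩ.measurableSet
  have : IsFiniteMeasure (volume.restrict Ω) := ⟨by simpa using hΩb.measure_lt_top⟩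
  have hPc : ContinuousOn (fun x => rexp (inner ℝ e (∇ u x))) Ω :=
    continuous_exp.comp_continuousOn
      (continuousOn_const.inner (hud.continuousOn_gradient hΩ))
  have hPm : AEStronglyMeasurable (fun x => rexp (inner ℝ e (∇ u x))) (volume.restrict Ω) :=
    hPc.aestronglyMeasurable hΩm
  have hPb : ∀ x ∈ Ω, ‖rexp (inner ℝ e (∇ u x))‖ ≤ rexp ‖e‖ := fun x hx => by
    rw [norm_eq_abs, abs_exp, exp_le_exp]
    exact (real_inner_le_norm _ _).trans
      (mul_le_of_le_one_right (norm_nonneg _) (hu1 x hx).le)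
  obtain ⟨C, hC⟩ := hv.continuous.bounded_above_of_compact_support hvc
  have hv'c : Continuous fun x => fderiv ℝ v x e :=
    (hv.continuous_fderiv one_ne_zero).clm_apply continuous_const
  obtain ⟨D, hD⟩ := hv'c.bounded_above_of_compact_support (hvc.fderiv_apply (𝕜 := ℝ) e)
  have hprod : ∀ (w : E → ℝ), Continuous w → ∀ c, (∀ x, ‖w x‖ ≤ c) →
      Integrable (fun x => rexp (inner ℝ e (∇ u x)) * w x) (volume.restrict Ω) := fun w hw c hc => by
    refine Integrable.mono' (integrable_const (rexp ‖e‖ * c))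
      (hPm.mul hw.aestronglyMeasurable) ?_
    filter_upwards [ae_restrict_mem hΩm] with x hx
    rw [norm_mul]
    exact mul_le_mul (hPb x hx) (hc x) (norm_nonneg _) (exp_pos _).le
  have hline : ∀ (x : E) (s : ℝ), HasDerivAt (fun s : ℝ => x + s • e) e s := fun x s => by
    simpa using ((hasDerivAt_id s).smul_const e).const_add x
  have hderiv := (hasDerivAt_integral_of_dominated_loc_of_deriv_le (μ := volume.restrict Ω)
    (F := fun t x => rexp (inner ℝ e (∇ u x)) * v (x + t • e))
    (F' := fun t x => rexp (inner ℝ e (∇ u x)) * fderiv ℝ v (x + t • e) e)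
    (bound := fun _ => rexp ‖e‖ * D) (x₀ := (0 : ℝ)) (s := univ) univ_mem
    (Eventually.of_forall fun t => hPm.mul
      (hv.continuous.comp (by fun_prop)).aestronglyMeasurable)
    (by simpa using hprod v hv.continuous C hC)
    (hPm.mul (hv'c.comp (g := fun x => fderiv ℝ v x e) (by fun_prop)).aestronglyMeasurable)
    (by
      filter_upwards [ae_restrict_mem hΩm] with x hx t _
      rw [norm_mul]
      exact mul_le_mul (hPb x hx) (hD _) (norm_nonneg _) (exp_pos _).le)
    (integrable_const _)
    (ae_of_all _ fun x t _ =>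
      ((hv.differentiable one_ne_zero _).hasFDerivAt.comp_hasDerivAt t (hline x t)).const_mul _)).2
  have hgoal : ∫ x in Ω, rexp (inner ℝ e (∇ u x)) * inner ℝ e (∇ v x) =
      ∫ x in Ω, rexp (inner ℝ e (∇ u x)) * fderiv ℝ v (x + (0 : ℝ) • e) e := by
    simp only [real_inner_comm _ e, inner_gradient_left, zero_smul, add_zero]
  rw [hgoal]
  obtain ⟨δ, hδ, hδΩ⟩ := hvc.isCompact.exists_thickening_subset_open hΩ hvΩ
  -- translating the test function along `e` does not increase the weighted integral
  have hmono : ∀ t : ℝ, 0 < t → t * ‖e‖ < δ →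
      ∫ x in Ω, rexp (inner ℝ e (∇ u x)) * v (x + t • e) ≤
        ∫ x in Ω, rexp (inner ℝ e (∇ u x)) * v (x + (0 : ℝ) • e) := by
    intro t ht hte
    set P : E → ℝ := Ω.indicator fun x => rexp (inner ℝ e (∇ u x)) with hP
    have hconv : ∀ w : E → ℝ, ∫ x in Ω, rexp (inner ℝ e (∇ u x)) * w x = ∫ x, P x * w x := by
      intro w
      rw [← integral_indicator hΩm]
      exact integral_congr_ae (ae_of_all _ fun x => indicator_mul_left Ω _ _)
    have hintP : ∀ s : ℝ, Integrable fun x => P x * v (x + s • e) := fun s => by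
      have := (integrable_indicator_iff hΩm).2
        (hprod (fun x => v (x + s • e)) (hv.continuous.comp (by fun_prop)) C fun x => hC _)
      exact this.congr (ae_of_all _ fun x => indicator_mul_left Ω _ _)
    have hshift : ∫ x, P x * v (x + t • e) = ∫ x, P (x - t • e) * v x := by
      rw [← integral_sub_right_eq_self (μ := volume) _ (t • e)]
      simp
    rw [hconv fun x => v (x + t • e), hconv fun x => v (x + (0 : ℝ) • e), hshift]
    refine integral_mono ?_ (hintP 0) fun x => ?_
    · simpa using (hintP t).comp_sub_right (t • e)
    · simp only [zero_smul, add_zero]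
      by_cases hx : x ∈ tsupport v
      · have hxΩ := hvΩ hx
        have hxt : x - t • e ∈ Ω := hδΩ (Metric.mem_thickening_iff.2 ⟨x, hx, by
          simpa [dist_eq_norm, norm_smul, abs_of_pos ht] using hte⟩)
        refine mul_le_mul_of_nonneg_right ?_ (hv0 x)
        rw [hP, indicator_of_mem hxΩ, indicator_of_mem hxt, exp_le_exp]
        exact hu.inner_gradient_sub_smul_le ht hxΩ hxt
          ((hud.differentiableOn one_ne_zero).differentiableAt (hΩ.mem_nhds hxΩ))
          ((hud.differentiableOn one_ne_zero).differentiableAt (hΩ.mem_nhds hxt))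
      · simp [image_eq_zero_of_notMem_tsupport hx]
  have hslope := (hasDerivAt_iff_tendsto_slope.1 hderiv).mono_left
    (nhdsWithin_mono (0 : ℝ) (s := Ioi 0) fun t ht => (ne_of_gt ht : t ≠ 0))
  refine le_of_tendsto hslope ?_
  have hsmall : ∀ᶠ t : ℝ in 𝓝[>] 0, t * ‖e‖ < δ := by
    refine Filter.Eventually.filter_mono nhdsWithin_le_nhds ?_
    exact (Continuous.tendsto' (by fun_prop) 0 0 (by simp) :
      Tendsto (fun t : ℝ => t * ‖e‖) (𝓝 0) (𝓝 0)).eventually_lt_const hδ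
  filter_upwards [hsmall, self_mem_nhdsWithin] with t ht ht0
  rw [slope_def_field]
  exact div_nonpos_of_nonpos_of_nonneg (sub_nonpos.2 (hmono t ht0 ht))
    (by simpa using (le_of_lt ht0))

end ConvexVariation

section Truncation

/-- The continuous piecewise linear function vanishing for `t ≤ 1 / c` and equal to `1` for
`t ≥ 2 / c`. -/
noncomputable def ramp (c t : ℝ) : ℝ := max 0 (min 1 (c * t - 1))

lemma continuous_ramp (c : ℝ) : Continuous (ramp c) := by unfold ramp; fun_prop

lemma ramp_nonneg (c t : ℝ) : 0 ≤ ramp c t := le_max_left _ _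

lemma ramp_le_one (c t : ℝ) : ramp c t ≤ 1 := max_le zero_le_one (min_le_left _ _)

lemma ramp_eq_zero {c t : ℝ} (h : c * t ≤ 1) : ramp c t = 0 :=
  max_eq_left ((min_le_right _ _).trans (by linarith))

lemma ramp_eq_one {c t : ℝ} (h : 2 ≤ c * t) : ramp c t = 1 := by
  rw [ramp, min_eq_left (by linarith), max_eq_right zero_le_one]

lemma tendsto_ramp {t : ℝ} (ht : 0 < t) :
    Tendsto (fun k : ℕ => ramp (k + 1) t) atTop (𝓝 1) := by
  have h : ∀ᶠ k : ℕ in atTop, (2 : ℝ) ≤ (k + 1) * t := by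
    obtain ⟨N, hN⟩ := exists_nat_ge (2 / t)
    filter_upwards [eventually_ge_atTop N] with k hk
    have hk' : (N : ℝ) ≤ k := by exact_mod_cast hk
    rw [div_le_iff₀ ht] at hN
    nlinarith
  exact tendsto_const_nhds.congr' (h.mono fun k hk => (ramp_eq_one hk).symm)

lemma hasDerivAt_integral_ramp (c t : ℝ) :
    HasDerivAt (fun t => ∫ s in (0 : ℝ)..t, ramp c s) (ramp c t) t :=
  ((continuous_ramp c).integral_hasStrictDerivAt 0 t).hasDerivAt

lemma contDiff_integral_ramp (c : ℝ) : ContDiff ℝ 1 fun t => ∫ s in (0 : ℝ)..t, ramp c s := by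
  rw [contDiff_one_iff_deriv]
  refine ⟨fun t => (hasDerivAt_integral_ramp c t).differentiableAt, ?_⟩
  rw [deriv_eq (hasDerivAt_integral_ramp c)]
  exact continuous_ramp c

lemma integral_ramp_nonneg {c t : ℝ} (ht : 0 ≤ t) : 0 ≤ ∫ s in (0 : ℝ)..t, ramp c s :=
  intervalIntegral.integral_nonneg ht fun s _ => ramp_nonneg c s

lemma integral_ramp_eq_zero {c t : ℝ} (hc : 0 ≤ c) (ht : 0 ≤ t) (h : c * t ≤ 1) :
    ∫ s in (0 : ℝ)..t, ramp c s = 0 := by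
  rw [intervalIntegral.integral_congr (g := fun _ => 0), intervalIntegral.integral_zero]
  intro s hs
  rw [uIcc_of_le ht] at hs
  exact ramp_eq_zero ((mul_le_mul_of_nonneg_left hs.2 hc).trans h)

variable {E : Type*} [NormedAddCommGroup E] [InnerProductSpace ℝ E] [FiniteDimensional ℝ E]

/-- A nonnegative function vanishing on the boundary can be truncated to a compactly supported
test function. -/
lemma exists_compactSupport_truncation {Ω : Set E} (hΩ : IsOpen Ω)
    (hΩb : Bornology.IsBounded Ω) {w : E → ℝ} (hwc : ContinuousOn w (closure Ω))
    (hwd : ContDiffOn ℝ 1 w Ω) (hw0 : ∀ x ∈ closure Ω, 0 ≤ w x)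
    (hwb : ∀ x ∈ frontier Ω, w x = 0) {c : ℝ} (hc : 0 < c) :
    ∃ v : E → ℝ, ContDiff ℝ 1 v ∧ (∀ x, 0 ≤ v x) ∧ HasCompactSupport v ∧ tsupport v ⊆ Ω ∧
      ∀ x ∈ Ω, ∇ v x = ramp c (w x) • ∇ w x := by
  set K : Set E := closure Ω ∩ w ⁻¹' Ici (1 / c) with hK
  have hKcl : IsClosed K := hwc.preimage_isClosed_of_isClosed isClosed_closure isClosed_Ici
  have hKc : IsCompact K := 
    hΩb.isCompact_closure.of_isClosed_subset hKcl inter_subset_left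
  have hKΩ : K ⊆ Ω := by
    rintro x ⟨hx, hxc⟩
    by_contra hxΩ
    have := hwb x ⟨hx, by rwa [hΩ.interior_eq]⟩
    rw [mem_preimage, this, mem_Ici] at hxc
    exact absurd hxc (not_le.2 (by positivity))
  set v : E → ℝ := Ω.indicator fun x => ∫ s in (0 : ℝ)..w x, ramp c s with hv
  have hvK : ∀ x ∉ K, v x = 0 := by
    intro x hx
    by_cases hxΩ : x ∈ Ω
    · rw [hv, indicator_of_mem hxΩ]
      have hlt : w x < 1 / c := by
        by_contra! hge
        exact hx ⟨subset_closure hxΩ, hge⟩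
      refine integral_ramp_eq_zero hc.le (hw0 x (subset_closure hxΩ)) ?_
      rw [lt_div_iff₀ hc] at hlt
      linarith
    · exact indicator_of_notMem hxΩ _
  have hsupp : tsupport v ⊆ K :=
    closure_minimal (fun x hx => by_contra fun h => hx (hvK x h)) hKcl
  have hevent : ∀ x ∈ Ω, v =ᶠ[𝓝 x] fun x => ∫ s in (0 : ℝ)..w x, ramp c s := fun x hx => by
    filter_upwards [hΩ.mem_nhds hx] with y hy
    exact indicator_of_mem hy _
  refine ⟨v, ?_, ?_, ?_, hsupp.trans hKΩ, ?_⟩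
  · refine contDiff_iff_contDiffAt.2 fun x => ?_
    by_cases hx : x ∈ Ω
    · exact ((contDiff_integral_ramp c).contDiffAt.comp x
        (hwd.contDiffAt (hΩ.mem_nhds hx))).congr_of_eventuallyEq (hevent x hx)
    · have : v =ᶠ[𝓝 x] fun _ => 0 := by
        filter_upwards [hKcl.isOpen_compl.mem_nhds fun h => hx (hKΩ h)] with y hy
        exact hvK y hy
      exact contDiffAt_const.congr_of_eventuallyEq this
  · exact fun x => indicator_nonneg
      (fun y hy => integral_ramp_nonneg (hw0 y (subset_closure hy))) x
  · exact hKc.of_isClosed_subset (isClosed_tsupport v) hsupp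
  · intro x hx
    have hwx : HasFDerivAt w (fderiv ℝ w x) x :=
      ((hwd.differentiableOn one_ne_zero).differentiableAt (hΩ.mem_nhds hx)).hasFDerivAt
    have hcomp := (hasDerivAt_integral_ramp c (w x)).comp_hasFDerivAt x hwx
    rw [(hevent x hx).gradient_eq]
    change ∇ ((fun t => ∫ s in (0 : ℝ)..t, ramp c s) ∘ w) x = _
    rw [gradient, hcomp.fderiv, gradient, map_smul]

end Truncation

section VolumeComparison

variable {E : Type*} [NormedAddCommGroup E]

lemma continuousOn_sqrt_sub_sqrt_sub {Ω : Set E} {p q : E → E} (hp : ContinuousOn p Ω)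
    (hq : ContinuousOn q Ω) : ContinuousOn
      (fun x => √(1 - ‖p x‖ ^ 2) - √(1 - ‖q x‖ ^ 2) - ‖p x - q x‖ ^ 2 / 2) Ω :=
  (((continuousOn_const.sub (hp.norm.pow 2)).sqrt).sub
    ((continuousOn_const.sub (hq.norm.pow 2)).sqrt)).sub (((hp.sub hq).norm.pow 2).div_const 2)

lemma abs_sqrt_sub_sqrt_sub_le {p q : E} (hp : ‖p‖ < 1) (hq : ‖q‖ < 1) :
    |√(1 - ‖p‖ ^ 2) - √(1 - ‖q‖ ^ 2) - ‖p - q‖ ^ 2 / 2| ≤ 4 := by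
  have h1 : √(1 - ‖p‖ ^ 2) ≤ 1 := sqrt_le_one.2 (by nlinarith [sq_nonneg ‖p‖])
  have h2 : √(1 - ‖q‖ ^ 2) ≤ 1 := sqrt_le_one.2 (by nlinarith [sq_nonneg ‖q‖])
  have h3 := sqrt_nonneg (1 - ‖p‖ ^ 2)
  have h4 := sqrt_nonneg (1 - ‖q‖ ^ 2)
  have h5 : ‖p - q‖ ≤ 2 := by linarith [norm_sub_le p q]
  have h6 : ‖p - q‖ ^ 2 ≤ 4 := by nlinarith [norm_nonneg (p - q)]
  rw [abs_le]
  constructor <;> linarith [sq_nonneg ‖p - q‖]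

variable [InnerProductSpace ℝ E]

/-- Quantitative concavity of `p ↦ √(1 - ‖p‖ ^ 2)` on the unit ball. -/
lemma half_norm_sub_sq_le_sqrt_sub {p q : E} (hp : ‖p‖ < 1) (hq : ‖q‖ < 1) :
    ‖p - q‖ ^ 2 / 2 ≤ √(1 - ‖p‖ ^ 2) - √(1 - ‖q‖ ^ 2) +
      inner ℝ p (p - q) / √(1 - ‖p‖ ^ 2) := by
  have hp2 : 0 < 1 - ‖p‖ ^ 2 := by nlinarith [norm_nonneg p]
  have hq2 : 0 < 1 - ‖q‖ ^ 2 := by nlinarith [norm_nonneg q]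
  have hfp := sq_sqrt hp2.le
  have hfq := sq_sqrt hq2.le
  have hf0 : 0 < √(1 - ‖p‖ ^ 2) := sqrt_pos.2 hp2
  have hf1 : √(1 - ‖p‖ ^ 2) ≤ 1 := sqrt_le_one.2 (by nlinarith [sq_nonneg ‖p‖])
  have hexp := norm_sub_sq_real p q
  rw [inner_sub_right, real_inner_self_eq_norm_sq]
  set a := √(1 - ‖p‖ ^ 2)
  set b := √(1 - ‖q‖ ^ 2)
  have : a - b + (‖p‖ ^ 2 - inner ℝ p q) / a =
      (a ^ 2 - a * b + (‖p‖ ^ 2 - inner ℝ p q)) / a := by field_simp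
  rw [this, le_div_iff₀ hf0]
  have h1 : ‖p - q‖ ^ 2 / 2 * a ≤ ‖p - q‖ ^ 2 / 2 :=
    mul_le_of_le_one_right (by positivity) hf1
  nlinarith [sq_nonneg (a - b)]

variable [FiniteDimensional ℝ E]

lemma gradient_eq_of_eq_of_eventually_le {u₁ u₂ : E → ℝ} {x : E}
    (h₁ : DifferentiableAt ℝ u₁ x) (h₂ : DifferentiableAt ℝ u₂ x)
    (hle : ∀ᶠ y in 𝓝 x, u₂ y ≤ u₁ y) (hx : u₁ x = u₂ x) : ∇ u₁ x = ∇ u₂ x := by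
  have hmin : IsLocalMin (u₁ - u₂) x := hle.mono fun y hy => by
    simpa [hx] using hy
  have h := hmin.fderiv_eq_zero
  rw [fderiv_sub h₁ h₂, sub_eq_zero] at h
  rw [gradient, gradient, h]

/-- Two functions with equal gradients on a bounded convex open set and equal boundary values
coincide. -/
lemma eqOn_of_gradient_eq_of_eq_frontier [Nontrivial E] {Ω : Set E} (hΩ : IsOpen Ω)
    (hΩb : Bornology.IsBounded Ω) (hΩc : Convex ℝ Ω) {u₁ u₂ : E → ℝ}
    (h₁c : ContinuousOn u₁ (closure Ω)) (h₂c : ContinuousOn u₂ (closure Ω))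
    (h₁d : DifferentiableOn ℝ u₁ Ω) (h₂d : DifferentiableOn ℝ u₂ Ω)
    (hg : ∀ x ∈ Ω, ∇ u₁ x = ∇ u₂ x) (hbd : ∀ x ∈ frontier Ω, u₁ x = u₂ x) :
    ∀ x ∈ Ω, u₁ x = u₂ x := by
  intro x hx
  obtain ⟨z, hz⟩ : (frontier Ω).Nonempty := nonempty_frontier_iff.2
    ⟨⟨x, hx⟩, fun h => NormedSpace.unbounded_univ ℝ E (h ▸ hΩb)⟩
  have hconst : ∀ y ∈ Ω, u₁ y - u₂ y = u₁ x - u₂ x := by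
    intro y hy
    refine hΩc.is_const_of_fderivWithin_eq_zero (𝕜 := ℝ) (h₁d.sub h₂d) (fun a ha => ?_) hy hx
    rw [fderivWithin_of_isOpen hΩ ha, fderiv_sub (h₁d.differentiableAt (hΩ.mem_nhds ha))
      (h₂d.differentiableAt (hΩ.mem_nhds ha)), ← toDual_gradient, ← toDual_gradient, hg a ha,
      sub_self]
  have hcl : EqOn (fun y => u₁ y - u₂ y) (fun _ => u₁ x - u₂ x) (closure Ω) :=
    EqOn.of_subset_closure hconst (h₁c.sub h₂c) continuousOn_const subset_closure le_rfl
  have h := hcl hz.1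
  simp only [hbd z hz, sub_self] at h
  linarith

variable [MeasurableSpace E] [BorelSpace E]

lemma integral_ramp_mul_nonneg {Ω : Set E} (hΩ : IsOpen Ω)
    (hΩb : Bornology.IsBounded Ω) {u₁ u₂ : E → ℝ}
    (h₁c : ContinuousOn u₁ (closure Ω)) (h₂c : ContinuousOn u₂ (closure Ω))
    (h₁d : ContDiffOn ℝ 1 u₁ Ω) (h₂d : ContDiffOn ℝ 1 u₂ Ω)
    (h₁sp : ∀ x ∈ Ω, ‖∇ u₁ x‖ < 1) (h₂sp : ∀ x ∈ Ω, ‖∇ u₂ x‖ < 1)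
    (hge : ∀ x ∈ closure Ω, u₂ x ≤ u₁ x)
    (hbd : ∀ x ∈ frontier Ω, u₁ x = u₂ x)
    (hconv : ConvexOn ℝ Ω u₁) {c : ℝ} (hc : 0 < c) :
    0 ≤ ∫ x in Ω, ramp c (u₁ x - u₂ x) *
      (√(1 - ‖∇ u₁ x‖ ^ 2) - √(1 - ‖∇ u₂ x‖ ^ 2) - ‖∇ u₁ x - ∇ u₂ x‖ ^ 2 / 2) := by
  have hΩm : MeasurableSet Ω := hΩ.measurableSet
  have : IsFiniteMeasure (volume.restrict Ω) := ⟨by simpa using hΩb.measure_lt_top⟩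
  have hg₁ := h₁d.continuousOn_gradient hΩ
  have hg₂ := h₂d.continuousOn_gradient hΩ
  obtain ⟨v, hv, hv0, hvc, hvΩ, hvg⟩ := exists_compactSupport_truncation hΩ hΩb (h₁c.sub h₂c)
    (h₁d.sub h₂d) (fun x hx => by simpa using hge x hx)
    (fun x hx => by simpa [sub_eq_zero] using hbd x hx) hc
  have hvg' : ∀ x ∈ Ω, ∇ v x = ramp c (u₁ x - u₂ x) • (∇ u₁ x - ∇ u₂ x) := fun x hx => by
    rw [hvg x hx, gradient, fderiv_sub, map_sub]
    · rfl
    · exact (h₁d.differentiableOn one_ne_zero).differentiableAt (hΩ.mem_nhds hx)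
    · exact (h₂d.differentiableOn one_ne_zero).differentiableAt (hΩ.mem_nhds hx)
  have hvgc : Continuous (∇ v) :=
    (InnerProductSpace.toDual ℝ E).symm.continuous.comp (hv.continuous_fderiv one_ne_zero)
  obtain ⟨r, hr0, hr1, hr⟩ : ∃ r, 0 ≤ r ∧ r < 1 ∧ ∀ x ∈ tsupport v, ‖∇ u₁ x‖ ≤ r := by
    rcases (tsupport v).eq_empty_or_nonempty with h | h
    · exact ⟨0, le_rfl, one_pos, by simp [h]⟩
    · obtain ⟨y, hy, hmax⟩ := hvc.isCompact.exists_isMaxOn h (hg₁.mono hvΩ).norm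
      exact ⟨_, norm_nonneg _, h₁sp y (hvΩ hy), fun x hx => hmax hx⟩
  have hbound : ∀ᵐ x ∂(volume.restrict Ω), ‖∇ v x‖ ≤ 2 := by
    filter_upwards [ae_restrict_mem hΩm] with x hx
    rw [hvg' x hx, norm_smul, norm_eq_abs, abs_of_nonneg (ramp_nonneg _ _)]
    have := norm_sub_le (∇ u₁ x) (∇ u₂ x)
    nlinarith [h₁sp x hx, h₂sp x hx, ramp_le_one c (u₁ x - u₂ x), ramp_nonneg c (u₁ x - u₂ x),
      norm_nonneg (∇ u₁ x - ∇ u₂ x)]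
  have hrv : ∀ x, ∇ v x ≠ 0 → ‖∇ u₁ x‖ ≤ r := fun x hx => hr x <| by
    by_contra hxs
    refine hx ?_
    rw [gradient, image_eq_zero_of_notMem_tsupport
      fun h => hxs (tsupport_fderiv_subset ℝ h), map_zero]
  obtain ⟨hint, hle⟩ := integral_inner_div_sqrt_nonpos hr0 hr1
    (hg₁.aestronglyMeasurable hΩm) hvgc.aestronglyMeasurable
    (by filter_upwards [ae_restrict_mem hΩm] with x hx using (h₁sp x hx).le) hbound
    (ae_of_all _ hrv)
    (hconv.integral_exp_inner_gradient_mul_nonpos hΩ hΩb h₁d h₁sp hv hv0 hvc hvΩ)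
  have hneg : 0 ≤ ∫ x in Ω, -(inner ℝ (∇ u₁ x) (∇ v x) / √(1 - ‖∇ u₁ x‖ ^ 2)) := by
    rw [integral_neg]; linarith
  refine hneg.trans (integral_mono_ae hint.neg ?_ ?_)
  · refine (integrable_const (4 : ℝ)).mono' ?_ ?_
    · exact (((continuous_ramp c).comp_continuousOn ((h₁c.sub h₂c).mono subset_closure)).mul
        (continuousOn_sqrt_sub_sqrt_sub hg₁ hg₂)).aestronglyMeasurable hΩm
    · filter_upwards [ae_restrict_mem hΩm] with x hx
      rw [norm_mul, norm_eq_abs, norm_eq_abs, abs_of_nonneg (ramp_nonneg _ _)]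
      refine (mul_le_of_le_one_left (abs_nonneg _) (ramp_le_one _ _)).trans ?_
      exact abs_sqrt_sub_sqrt_sub_le (h₁sp x hx) (h₂sp x hx)
  · filter_upwards [ae_restrict_mem hΩm] with x hx
    have h := half_norm_sub_sq_le_sqrt_sub (h₁sp x hx) (h₂sp x hx)
    rw [hvg' x hx, inner_smul_right, mul_div_assoc, ← mul_neg]
    exact mul_le_mul_of_nonneg_left (by linarith) (ramp_nonneg _ _)

/-- Letting the truncation tend to the identity in `integral_ramp_mul_nonneg`. -/
lemma integral_sqrt_sub_sqrt_sub_nonneg {Ω : Set E} (hΩ : IsOpen Ω)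
    (hΩb : Bornology.IsBounded Ω) {u₁ u₂ : E → ℝ}
    (h₁c : ContinuousOn u₁ (closure Ω)) (h₂c : ContinuousOn u₂ (closure Ω))
    (h₁d : ContDiffOn ℝ 1 u₁ Ω) (h₂d : ContDiffOn ℝ 1 u₂ Ω)
    (h₁sp : ∀ x ∈ Ω, ‖∇ u₁ x‖ < 1) (h₂sp : ∀ x ∈ Ω, ‖∇ u₂ x‖ < 1)
    (hge : ∀ x ∈ closure Ω, u₂ x ≤ u₁ x)
    (hbd : ∀ x ∈ frontier Ω, u₁ x = u₂ x)
    (hconv : ConvexOn ℝ Ω u₁) :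
    0 ≤ ∫ x in Ω, (√(1 - ‖∇ u₁ x‖ ^ 2) - √(1 - ‖∇ u₂ x‖ ^ 2) - ‖∇ u₁ x - ∇ u₂ x‖ ^ 2 / 2) := by
  have hΩm : MeasurableSet Ω := hΩ.measurableSet
  have : IsFiniteMeasure (volume.restrict Ω) := ⟨by simpa using hΩb.measure_lt_top⟩
  have hcont := continuousOn_sqrt_sub_sqrt_sub (h₁d.continuousOn_gradient hΩ)
    (h₂d.continuousOn_gradient hΩ)
  refine ge_of_tendsto' (tendsto_integral_of_dominated_convergence
    (F := fun (k : ℕ) x => ramp (k + 1) (u₁ x - u₂ x) *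
      (√(1 - ‖∇ u₁ x‖ ^ 2) - √(1 - ‖∇ u₂ x‖ ^ 2) - ‖∇ u₁ x - ∇ u₂ x‖ ^ 2 / 2))
    (fun _ => (4 : ℝ)) (fun k => (((continuous_ramp (k + 1)).comp_continuousOn
      ((h₁c.sub h₂c).mono subset_closure)).mul hcont).aestronglyMeasurable hΩm) (integrable_const _) (fun k => ?_) ?_)
    (fun k => integral_ramp_mul_nonneg hΩ hΩb h₁c h₂c h₁d h₂d h₁sp h₂sp hge hbd hconv
      (Nat.cast_add_one_pos k))
  · filter_upwards [ae_restrict_mem hΩm] with x hx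
    rw [norm_mul, norm_eq_abs, norm_eq_abs, abs_of_nonneg (ramp_nonneg _ _)]
    exact (mul_le_of_le_one_left (abs_nonneg _) (ramp_le_one _ _)).trans
      (abs_sqrt_sub_sqrt_sub_le (h₁sp x hx) (h₂sp x hx))
  · filter_upwards [ae_restrict_mem hΩm] with x hx
    rcases (hge x (subset_closure hx)).lt_or_eq with h | h
    · simpa using (tendsto_ramp (sub_pos.2 h)).mul_const
        (√(1 - ‖∇ u₁ x‖ ^ 2) - √(1 - ‖∇ u₂ x‖ ^ 2) - ‖∇ u₁ x - ∇ u₂ x‖ ^ 2 / 2)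
    · have hgrad : ∇ u₁ x = ∇ u₂ x := gradient_eq_of_eq_of_eventually_le
        ((h₁d.differentiableOn one_ne_zero).differentiableAt (hΩ.mem_nhds hx))
        ((h₂d.differentiableOn one_ne_zero).differentiableAt (hΩ.mem_nhds hx))
        (by filter_upwards [hΩ.mem_nhds hx] with y hy using hge y (subset_closure hy)) h.symm
      simp [hgrad]

lemma integrableOn_sqrt_one_sub_norm_gradient_sq {Ω : Set E} (hΩ : IsOpen Ω)
    (hΩb : Bornology.IsBounded Ω) {u : E → ℝ} (hu : ContDiffOn ℝ 1 u Ω) :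
    IntegrableOn (fun x => √(1 - ‖∇ u x‖ ^ 2)) Ω := by
  have : IsFiniteMeasure (volume.restrict Ω) := ⟨by simpa using hΩb.measure_lt_top⟩
  refine Integrable.mono' (integrable_const (1 : ℝ))
    (((continuousOn_const.sub ((hu.continuousOn_gradient hΩ).norm.pow 2)).sqrt
      ).aestronglyMeasurable hΩ.measurableSet) (ae_of_all _ fun x => ?_)
  rw [norm_eq_abs, abs_of_nonneg (sqrt_nonneg _)]
  exact sqrt_le_one.2 (by nlinarith [sq_nonneg ‖∇ u x‖])

end VolumeComparison

/-- volume comparison for spacelike graphs. If `u₁ ≥ u₂` on the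
closure of a bounded open set `Ω ⊆ ℝⁿ` (`n = m + 1 ≥ 1`), `u₁ = u₂` on `∂Ω`,
both are `C¹` and spacelike on `Ω`, and `u₁` is convex on `Ω`, then the Minkowski
volume of the graph of `u₁` is at least that of `u₂`, with equality iff `u₁ = u₂`
on `Ω`. -/
theorem stmt_17 (m : ℕ) (Ω : Set (EuclideanSpace ℝ (Fin (m + 1))))
    (hΩo : IsOpen Ω) (hΩb : Bornology.IsBounded Ω)
    (u₁ u₂ : EuclideanSpace ℝ (Fin (m + 1)) → ℝ)
    (h₁c : ContinuousOn u₁ (closure Ω)) (h₂c : ContinuousOn u₂ (closure Ω))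
    (h₁d : ContDiffOn ℝ 1 u₁ Ω) (h₂d : ContDiffOn ℝ 1 u₂ Ω)
    (h₁sp : ∀ x ∈ Ω, ‖gradient u₁ x‖ < 1) (h₂sp : ∀ x ∈ Ω, ‖gradient u₂ x‖ < 1)
    (hge : ∀ x ∈ closure Ω, u₂ x ≤ u₁ x)
    (hbd : ∀ x ∈ frontier Ω, u₁ x = u₂ x)
    (hconv : ConvexOn ℝ Ω u₁) :
    (∫ x in Ω, Real.sqrt (1 - ‖gradient u₂ x‖ ^ 2)) ≤
      (∫ x in Ω, Real.sqrt (1 - ‖gradient u₁ x‖ ^ 2)) ∧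
    ((∫ x in Ω, Real.sqrt (1 - ‖gradient u₁ x‖ ^ 2)) =
      (∫ x in Ω, Real.sqrt (1 - ‖gradient u₂ x‖ ^ 2)) ↔ ∀ x ∈ Ω, u₁ x = u₂ x) := by
  have hΩm : MeasurableSet Ω := hΩo.measurableSet
  have : IsFiniteMeasure (volume.restrict Ω) := ⟨by simpa using hΩb.measure_lt_top⟩
  have hg₁ := h₁d.continuousOn_gradient hΩo
  have hg₂ := h₂d.continuousOn_gradient hΩo
  have hint₁ := integrableOn_sqrt_one_sub_norm_gradient_sq hΩo hΩb h₁d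
  have hint₂ := integrableOn_sqrt_one_sub_norm_gradient_sq hΩo hΩb h₂d
  have hint : IntegrableOn (fun x => ‖∇ u₁ x - ∇ u₂ x‖ ^ 2 / 2) Ω := by
    refine Integrable.mono' (integrable_const (2 : ℝ))
      (((hg₁.sub hg₂).norm.pow 2).div_const 2 |>.aestronglyMeasurable hΩm) ?_
    filter_upwards [ae_restrict_mem hΩm] with x hx
    rw [norm_eq_abs, abs_of_nonneg (by positivity)]
    nlinarith [norm_sub_le (∇ u₁ x) (∇ u₂ x), h₁sp x hx, h₂sp x hx,
      norm_nonneg (∇ u₁ x - ∇ u₂ x)]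
  have hkey := integral_sqrt_sub_sqrt_sub_nonneg hΩo hΩb h₁c h₂c h₁d h₂d h₁sp h₂sp hge hbd
    hconv
  rw [integral_sub (f := fun x => √(1 - ‖∇ u₁ x‖ ^ 2) - √(1 - ‖∇ u₂ x‖ ^ 2)) (hint₁.sub hint₂) hint,
    integral_sub hint₁ hint₂] at hkey
  have hnonneg : 0 ≤ ∫ x in Ω, ‖∇ u₁ x - ∇ u₂ x‖ ^ 2 / 2 :=
    integral_nonneg fun x => by positivity
  refine ⟨by linarith, fun heq => ?_, fun heq => ?_⟩
  · have hzero : ∫ x in Ω, ‖∇ u₁ x - ∇ u₂ x‖ ^ 2 / 2 = 0 := by linarith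
    rw [integral_eq_zero_iff_of_nonneg (fun x => by positivity) hint] at hzero
    have hEq := Measure.eqOn_open_of_ae_eq hzero hΩo (((hg₁.sub hg₂).norm.pow 2).div_const 2)
      continuousOn_const
    refine eqOn_of_gradient_eq_of_eq_frontier hΩo hΩb hconv.1 h₁c h₂c
      (h₁d.differentiableOn one_ne_zero) (h₂d.differentiableOn one_ne_zero) (fun x hx => ?_) hbd
    simpa [sub_eq_zero] using hEq hx
  · refine setIntegral_congr_fun hΩm fun x hx => ?_
    have hx' : u₁ =ᶠ[𝓝 x] u₂ := by
      filter_upwards [hΩo.mem_nhds hx] with y hy using heq y hy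
    simp only [hx'.gradient_eq]
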